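/- There is no quadruple of positive integers (k₁, l₁, k₂, l₂) satisfying k₁ > l₁, k₂ > l₂, k₁² + k₁l₁ + l₁² = k₂² + k₂l₂ + l₂², and (2k₂ + l₂)(2l₂ + k₂)(k₂ − l₂) = 2·(2k₁ + l₁)(2l₁ + k₁)(k₁ − l₁). -/

import Mathlib

/-- The Eisenstein integers. -/
abbrev Eis := QuadraticAlgebra ℤ (-1) (-1)

namespace Eis

/-- The norm form on the Eisenstein integers. -/
def nm (x : Eis) : ℤ := x.re ^ 2 - x.re * x.im + x.im ^ 2

/-- A primitive cube root of unity. -/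
def w : Eis := ⟨0, 1⟩

/-- The ramified prime. -/
def lam : Eis := ⟨1, -1⟩

lemma nm_mul (x y : Eis) : nm (x * y) = nm x * nm y := by
  simp [nm]; ring

lemma nm_nonneg (x : Eis) : 0 ≤ nm x := by
  unfold nm; nlinarith [sq_nonneg (x.re - x.im), sq_nonneg x.re, sq_nonneg x.im]

lemma nm_eq_zero {x : Eis} (h : nm x = 0) : x = 0 := by
  unfold nm at h
  have h1 : x.re ^ 2 = 0 := by
    nlinarith [sq_nonneg (x.re - x.im), sq_nonneg x.re, sq_nonneg x.im]
  have h2 : x.im ^ 2 = 0 := by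
    nlinarith [sq_nonneg (x.re - x.im), sq_nonneg x.re, sq_nonneg x.im]
  ext
  · simpa using h1
  · simpa using h2

lemma nm_pos {x : Eis} (h : x ≠ 0) : 0 < nm x :=
  lt_of_le_of_ne (nm_nonneg x) fun h' => h (nm_eq_zero h'.symm)

lemma nm_one : nm 1 = 1 := by
  simp [nm, QuadraticAlgebra.re_one, QuadraticAlgebra.im_one]

lemma w_eq : w ^ 2 + w + 1 = 0 := by decide

lemma lam_eq : lam = 1 - w := by decide

lemma near (p n : ℤ) (hn : 0 < n) : ∃ q, -n ≤ 2 * (p - q * n) ∧ 2 * (p - q * n) ≤ n := by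
  have h0 := Int.emod_nonneg (2 * p + n) (by linarith : 2 * n ≠ 0)
  have h1 := Int.emod_lt_of_pos (2 * p + n) (by linarith : 0 < 2 * n)
  have h2 := Int.mul_ediv_add_emod (2 * p + n) (2 * n)
  refine ⟨(2 * p + n) / (2 * n), ?_⟩
  generalize (2 * p + n) / (2 * n) = q at *
  generalize (2 * p + n) % (2 * n) = m at *
  constructor <;> nlinarith

lemma exists_quot (x y : Eis) : ∃ q : Eis, (y = 0 → q = 0) ∧ (y ≠ 0 → nm (x - y * q) < nm y) := by
  by_cases hy : y = 0
  · exact ⟨0, fun _ => rfl, fun h => absurd hy h⟩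
  have hn := nm_pos hy
  obtain ⟨q1, h1, h1'⟩ := near (x.re * (y.re - y.im) + x.im * y.im) (nm y) hn
  obtain ⟨q2, h2, h2'⟩ := near (x.im * y.re - x.re * y.im) (nm y) hn
  refine ⟨⟨q1, q2⟩, fun h => absurd h hy, fun _ => ?_⟩
  set e := x.re * (y.re - y.im) + x.im * y.im - q1 * nm y with he
  set f := x.im * y.re - x.re * y.im - q2 * nm y with hf
  have key : nm (x - y * ⟨q1, q2⟩) * nm y = e ^ 2 - e * f + f ^ 2 := by
    rw [he, hf]; simp [nm]; ring
  have hb : 4 * (e ^ 2 - e * f + f ^ 2) ≤ 3 * nm y ^ 2 := by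
    nlinarith [mul_nonneg (sub_nonneg.2 h1) (sub_nonneg.2 h1'), mul_nonneg (sub_nonneg.2 h2) (sub_nonneg.2 h2'),
      mul_nonneg (sub_nonneg.2 h1) (sub_nonneg.2 h2), mul_nonneg (sub_nonneg.2 h1') (sub_nonneg.2 h2'),
      mul_nonneg (sub_nonneg.2 h1) (sub_nonneg.2 h2'), mul_nonneg (sub_nonneg.2 h1') (sub_nonneg.2 h2)]
  by_contra hc
  push Not at hc
  nlinarith

noncomputable instance : EuclideanDomain Eis :=
  { (inferInstance : CommRing Eis), (inferInstance : Nontrivial Eis) with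
    quotient := fun x y => (exists_quot x y).choose
    remainder := fun x y => x - y * (exists_quot x y).choose
    quotient_zero := fun x => (exists_quot x 0).choose_spec.1 rfl
    quotient_mul_add_remainder_eq := fun x y => by ring
    r := fun x y => (nm x).toNat < (nm y).toNat
    r_wellFounded := (measure fun x : Eis => (nm x).toNat).wf
    remainder_lt := fun x y hy => by
      have := (exists_quot x y).choose_spec.2 hy
      have := nm_pos hy
      omega
    mul_left_not_lt := fun x y hy => by
      have h1 := nm_pos hy
      have h2 := nm_nonneg x
      have h3 : nm x ≤ nm (x * y) := by rw [nm_mul]; nlinarith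
      omega }

lemma isUnit_of_nm {x : Eis} (h : nm x = 1) : IsUnit x := by
  refine IsUnit.of_mul_eq_one (⟨x.re - x.im, -x.im⟩ : Eis) ?_
  unfold nm at h
  ext
  · simp [QuadraticAlgebra.re_one]; linarith
  · simp [QuadraticAlgebra.im_one]; ring

lemma nm_of_isUnit {x : Eis} (h : IsUnit x) : nm x = 1 := by
  obtain ⟨y, hy⟩ := h.exists_right_inv
  have h1 : nm x * nm y = 1 := by rw [← nm_mul, hy, nm_one]
  exact Int.eq_one_of_mul_eq_one_right (nm_nonneg x) h1

/-- The six units. -/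
lemma units_list {x : Eis} (h : IsUnit x) :
    x = 1 ∨ x = -1 ∨ x = w ∨ x = -w ∨ x = w ^ 2 ∨ x = -w ^ 2 := by
  have h1 := nm_of_isUnit h
  unfold nm at h1
  obtain ⟨a, b⟩ := x
  simp only at h1
  have ha : a ≤ 1 := by nlinarith [sq_nonneg (a - 2 * b)]
  have ha' : -1 ≤ a := by nlinarith [sq_nonneg (a - 2 * b)]
  have hb : b ≤ 1 := by nlinarith [sq_nonneg (b - 2 * a)]
  have hb' : -1 ≤ b := by nlinarith [sq_nonneg (b - 2 * a)]
  interval_cases a <;> interval_cases b <;> first | (exfalso; omega) | decide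

lemma unit_cube {x : Eis} (h : IsUnit x) : x ^ 3 = 1 ∨ x ^ 3 = -1 := by
  rcases units_list h with h | h | h | h | h | h <;> subst h <;> decide

lemma re_two : (2 : Eis).re = 2 := rfl

lemma im_two : (2 : Eis).im = 0 := rfl

lemma two_dvd (x : Eis) : 2 ∣ x ↔ 2 ∣ nm x := by
  constructor
  · rintro ⟨y, rfl⟩
    rw [nm_mul]
    exact Dvd.dvd.mul_right (by decide) _
  · intro h
    have h1 : 2 ∣ x.re ∧ 2 ∣ x.im := by
      unfold nm at h
      rcases Int.emod_two_eq_zero_or_one x.re with h1 | h1 <;>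
      rcases Int.emod_two_eq_zero_or_one x.im with h2 | h2 <;>
      have h3 := Int.emod_emod_of_dvd (x.re ^ 2 - x.re * x.im + x.im ^ 2) (dvd_refl (2:ℤ)) <;>
      have h4 := Int.emod_eq_zero_of_dvd h <;>
      simp [Int.add_emod, Int.sub_emod, Int.mul_emod, pow_two, h1, h2] at h4 <;>
      omega
    obtain ⟨⟨a, ha⟩, ⟨b, hb⟩⟩ := h1
    refine ⟨⟨a, b⟩, ?_⟩
    ext <;> simp [ha, hb, re_two, im_two]

lemma prime_two : Prime (2 : Eis) := by
  refine ⟨by decide, fun h => ?_, fun a b h => ?_⟩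
  · have := nm_of_isUnit h
    revert this; decide
  · rw [two_dvd, nm_mul] at h
    rw [two_dvd, two_dvd]
    exact Int.prime_two.dvd_or_dvd h

lemma lam_dvd (x : Eis) : lam ∣ x ↔ 3 ∣ x.re + x.im := by
  constructor
  · rintro ⟨y, rfl⟩
    simp [lam]
    omega
  · rintro ⟨c, hc⟩
    -- x = lam * y
    refine ⟨⟨x.re - c, c⟩, ?_⟩
    ext <;> simp [lam] <;> linarith

lemma prime_lam : Prime lam := by
  refine ⟨by decide, fun h => ?_, fun a b h => ?_⟩
  · have := nm_of_isUnit h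
    revert this; decide
  · rw [lam_dvd] at *
    rw [lam_dvd]
    have : (a * b).re + (a * b).im = (a.re + a.im) * (b.re + b.im) - 3 * (a.im * b.im) := by
      simp; ring
    rw [this] at h
    refine Int.prime_three.dvd_or_dvd ?_
    have := dvd_add h (Dvd.intro (a.im * b.im) rfl)
    simpa using this

/-- Modulo two, a cube of an element prime to two is one. -/
lemma cube_mod_two {x : Eis} (h : ¬ 2 ∣ x) : 2 ∣ x ^ 3 - 1 := by
  have e : x ^ 3 - 1 = (x - 1) * (x - w) * (x - w ^ 2) := by
    linear_combination (x ^ 2 - x + (w - 1) * (1 - x)) * w_eq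
  have key : 2 ∣ x ∨ 2 ∣ x - 1 ∨ 2 ∣ x - w ∨ 2 ∣ x - w ^ 2 := by
    have aux : ∀ z : Eis, 2 ∣ z.re → 2 ∣ z.im → (2 : Eis) ∣ z := by
      rintro z ⟨a, ha⟩ ⟨b, hb⟩
      exact ⟨⟨a, b⟩, by ext <;> simp [ha, hb, re_two, im_two]⟩
    have hw2 : w ^ 2 = ⟨-1, -1⟩ := by decide
    rcases Int.emod_two_eq_zero_or_one x.re with h1 | h1 <;>
    rcases Int.emod_two_eq_zero_or_one x.im with h2 | h2
    · left; apply aux <;> omega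
    · right; right; left; apply aux <;> simp [w] <;> omega
    · right; left; apply aux <;> simp [QuadraticAlgebra.re_one, QuadraticAlgebra.im_one] <;> omega
    · right; right; right; rw [hw2]; apply aux <;> simp <;> omega
  rw [e]
  rcases key with k | k | k | k
  · exact absurd k h
  · exact (k.mul_right _).mul_right _
  · exact (k.mul_left _).mul_right _
  · exact k.mul_left _

/-- A unit congruent to one modulo two is a sign. -/
lemma unit_mod_two {u : Eis} (hu : IsUnit u) (h : 2 ∣ u - 1) : u = 1 ∨ u = -1 := by
  rw [two_dvd] at h
  rcases units_list hu with rfl | rfl | rfl | rfl | rfl | rfl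
  · left; rfl
  · right; rfl
  all_goals (exfalso; revert h; decide)

lemma core {n : ℤ}
    (IH : ∀ s t r u : Eis, nm r < n → IsUnit u → IsCoprime s t → r ≠ 0 →
      s ^ 3 + t ^ 3 = 2 * u * r ^ 3 → IsUnit s ∧ IsUnit t)
    {α β γ u r : Eis} (hu : IsUnit u) (hr : r ≠ 0) (hn : nm r ≤ n) (hsum : α + β + γ = 0)
    (hco : IsCoprime α β) (hp : α * β * γ = 2 * u * r ^ 3) (h2 : 2 ∣ α) : β = γ := by
  obtain ⟨a, rfl⟩ := h2
  have hγ : γ = -(2 * a) - β := by linear_combination hsum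
  have hβγ : IsCoprime β γ := by
    obtain ⟨p, q, h⟩ := hco
    exact ⟨q - p, -p, by rw [hγ]; linear_combination h⟩
  have hαγ : IsCoprime (2 * a) γ := by
    obtain ⟨p, q, h⟩ := hco
    exact ⟨p - q, -q, by rw [hγ]; linear_combination h⟩
  have haβ : IsCoprime a β := hco.of_mul_left_right
  have haγ : IsCoprime a γ := hαγ.of_mul_left_right
  have hprod : a * β * γ = u * r ^ 3 := by
    have h20 : (2 : Eis) ≠ 0 := prime_two.ne_zero
    apply mul_left_cancel₀ h20
    linear_combination hp
  have hass : Associated (r ^ 3) (a * β * γ) := by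
    obtain ⟨u', rfl⟩ := hu
    exact ⟨u', by rw [hprod]; ring⟩
  obtain ⟨r1, u1, h1⟩ := exists_associated_pow_of_associated_pow_mul (k := 3) (c := r)
    (haβ.mul_right haγ) (by rwa [← mul_assoc])
  obtain ⟨s1, u2, h2⟩ := exists_associated_pow_of_associated_pow_mul (k := 3) (c := r)
    (haβ.symm.mul_right hβγ) (by convert hass using 1; ring)
  obtain ⟨t1, u3, h3⟩ := exists_associated_pow_of_associated_pow_mul (k := 3) (c := r)
    (haγ.symm.mul_right hβγ.symm) (by convert hass using 1; ring)
  have nr : nm r ^ 3 = (nm r1 * nm s1 * nm t1) ^ 3 := by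
    have := congrArg nm hprod
    rw [← h1, ← h2, ← h3] at this
    simp only [pow_succ, pow_zero, one_mul, nm_mul, nm_of_isUnit u1.isUnit,
      nm_of_isUnit u2.isUnit, nm_of_isUnit u3.isUnit, nm_of_isUnit hu, mul_one] at this ⊢
    linarith
  have nr' : nm r = nm r1 * nm s1 * nm t1 := by
    have h3o : Odd 3 := by decide
    exact h3o.strictMono_pow.injective nr
  have hrpos := nm_pos hr
  have hr1 : r1 ≠ 0 := by
    rintro rfl; simp [nm] at nr' hrpos; omega
  have hs1 : s1 ≠ 0 := by
    rintro rfl; simp [nm] at nr' hrpos; omega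
  have ht1 : t1 ≠ 0 := by
    rintro rfl; simp [nm] at nr' hrpos; omega
  have hs2 : ¬ 2 ∣ s1 := by
    intro h
    refine prime_two.not_isUnit (hco.isUnit_of_dvd' (dvd_mul_right _ _) ?_)
    rw [← h2]
    exact (dvd_pow h (by norm_num)).mul_right _
  have ht2 : ¬ 2 ∣ t1 := by
    intro h
    refine prime_two.not_isUnit (hαγ.isUnit_of_dvd' (dvd_mul_right _ _) ?_)
    rw [← h3]
    exact (dvd_pow h (by norm_num)).mul_right _
  -- the units agree up to sign
  have hε : ∃ ε : Eis, (ε = 1 ∨ ε = -1) ∧ (u3 : Eis) = ε * u2 := by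
    refine ⟨u3 * (u2⁻¹ : Eisˣ), unit_mod_two (u3 * u2⁻¹).isUnit ?_, by simp⟩
    obtain ⟨p, hp⟩ := cube_mod_two hs2
    obtain ⟨q, hq⟩ := cube_mod_two ht2
    have hinv : (u2 : Eis) * (u2⁻¹ : Eisˣ) = 1 := by simp
    refine ⟨(u2⁻¹ : Eisˣ) * (- a - u2 * p - u3 * q) - 1, ?_⟩
    linear_combination (u2⁻¹ : Eisˣ) * (hsum + h2 + h3 - hp * u2 - hq * u3) - hinv
  obtain ⟨ε, hε, h3u⟩ := hε
  have hε3 : ε ^ 3 = ε := by rcases hε with rfl | rfl <;> ring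
  have hεu : IsUnit ε := by rcases hε with rfl | rfl <;> simp
  have hinv : (u2 : Eis) * (u2⁻¹ : Eisˣ) = 1 := by simp
  have heq : s1 ^ 3 + (ε * t1) ^ 3 = 2 * (-u1 * (u2⁻¹ : Eisˣ)) * r1 ^ 3 := by
    rw [mul_pow, hε3]
    rw [← h1, ← h2, ← h3, h3u] at hsum
    linear_combination (u2⁻¹ : Eisˣ) * hsum - (s1 ^ 3 + ε * t1 ^ 3) * hinv
  have hcop : IsCoprime s1 (ε * t1) := by
    rw [isCoprime_mul_unit_left_right hεu]
    rw [← h2, ← h3] at hβγ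
    have := hβγ.of_mul_left_left.of_mul_right_left
    exact (IsCoprime.pow_iff (by norm_num) (by norm_num)).1 this
  have hun : IsUnit s1 ∧ IsUnit (ε * t1) := by
    by_cases hlt : nm r1 < n
    · exact IH s1 (ε * t1) r1 _ hlt (by
        rw [neg_mul, IsUnit.neg_iff]; exact (u1 * u2⁻¹).isUnit) hcop hr1 heq
    · have p1 := nm_pos hr1
      have p2 := nm_pos hs1
      have p3 := nm_pos ht1
      push Not at hlt
      have hle : nm r1 * (nm s1 * nm t1) ≤ nm r1 * 1 := by rw [← mul_assoc]; linarith
      have hle' := le_of_mul_le_mul_left hle p1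
      refine ⟨isUnit_of_nm ?_, hεu.mul (isUnit_of_nm ?_)⟩ <;> nlinarith
  have hne : s1 ^ 3 + (ε * t1) ^ 3 ≠ 0 := by
    rw [heq]
    have hu' : (-u1 * (u2⁻¹ : Eisˣ) : Eis) ≠ 0 := by simp
    exact mul_ne_zero (mul_ne_zero prime_two.ne_zero hu') (pow_ne_zero _ hr1)
  have hfin : s1 ^ 3 = (ε * t1) ^ 3 := by
    rcases unit_cube hun.1 with h | h <;> rcases unit_cube hun.2 with h' | h' <;>
      rw [h, h'] at hne ⊢ <;> simp at hne
  rw [mul_pow, hε3] at hfin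
  rw [← h2, ← h3, h3u, hfin]; ring

lemma core' {n : ℤ}
    (IH : ∀ s t r u : Eis, nm r < n → IsUnit u → IsCoprime s t → r ≠ 0 →
      s ^ 3 + t ^ 3 = 2 * u * r ^ 3 → IsUnit s ∧ IsUnit t)
    {α β γ u r : Eis} (hu : IsUnit u) (hr : r ≠ 0) (hn : nm r ≤ n) (hsum : α + β + γ = 0)
    (hco : IsCoprime α β) (hp : α * β * γ = 2 * u * r ^ 3) : α = β ∨ α = γ ∨ β = γ := by
  have h2 : 2 ∣ α * β * γ := by rw [hp, mul_assoc]; exact dvd_mul_right _ _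
  rcases prime_two.dvd_or_dvd h2 with h | h
  · rcases prime_two.dvd_or_dvd h with h | h
    · exact Or.inr (Or.inr (core IH hu hr hn hsum hco hp h))
    · exact Or.inr (Or.inl (core IH hu hr hn (by linear_combination hsum) hco.symm
        (by linear_combination hp) h))
  · have hγα : IsCoprime γ α := by
      obtain ⟨p, q, h⟩ := hco
      exact ⟨-q, p - q, by linear_combination h - q * hsum⟩
    exact Or.inl (core IH hu hr hn (by linear_combination hsum) hγα
        (by linear_combination hp) h)

lemma descent (n : ℕ) : ∀ s t r u : Eis, nm r < n → IsUnit u → IsCoprime s t → r ≠ 0 →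
      s ^ 3 + t ^ 3 = 2 * u * r ^ 3 → IsUnit s ∧ IsUnit t := by
  induction n with
  | zero => intro s t r u h; have := nm_nonneg r; simp at h; omega
  | succ n ih =>
    intro s t r u hn hu hco hr heq
    have hn' : nm r ≤ n := by push_cast at hn; omega
    have hw := w_eq
    have hlam := lam_eq
    have hl0 := prime_lam.ne_zero
    have hw0 : w ≠ 0 := by decide
    suffices H : s + t = w * (s + w * t) ∨ s + t = w ^ 2 * (s + w ^ 2 * t) ∨
        w * (s + w * t) = w ^ 2 * (s + w ^ 2 * t) by
      rcases H with H | H | H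
      · have : s = w ^ 2 * t := by
          apply mul_left_cancel₀ hl0
          rw [hlam]; linear_combination H + (w - 1) * t * hw
        have h' : t = w * s := by rw [this]; linear_combination (-(w - 1) * t) * hw
        exact ⟨hco.isUnit_of_dvd' dvd_rfl ⟨w, by rw [mul_comm]; exact h'⟩,
          hco.isUnit_of_dvd' ⟨w ^ 2, by rw [mul_comm]; exact this⟩ dvd_rfl⟩
      · have : t = w ^ 2 * s := by
          apply mul_left_cancel₀ hl0
          rw [hlam]; linear_combination H + ((w - 1) * s + (w ^ 2 - w) * t) * hw
        have h' : s = w * t := by rw [this]; linear_combination (-(w - 1) * s) * hw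
        exact ⟨hco.isUnit_of_dvd' dvd_rfl ⟨w ^ 2, by rw [mul_comm]; exact this⟩,
          hco.isUnit_of_dvd' ⟨w, by rw [mul_comm]; exact h'⟩ dvd_rfl⟩
      · have : s = t := by
          apply mul_left_cancel₀ hl0
          apply mul_left_cancel₀ hw0
          rw [hlam]; linear_combination H + (w ^ 2 - w) * t * hw
        subst this
        exact ⟨hco.isUnit_of_dvd' dvd_rfl dvd_rfl, hco.isUnit_of_dvd' dvd_rfl dvd_rfl⟩
    have hsum : (s + t) + w * (s + w * t) + w ^ 2 * (s + w ^ 2 * t) = 0 := by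
      linear_combination (s + (w ^ 2 - w + 1) * t) * hw
    have hprod : (s + t) * (w * (s + w * t)) * (w ^ 2 * (s + w ^ 2 * t)) = 2 * u * r ^ 3 := by
      rw [← heq]
      have w3 : w ^ 3 = 1 := by decide
      have e : w ^ 2 = -w - 1 := by linear_combination hw
      have : (s + t) * (w * (s + w * t)) * (w ^ 2 * (s + w ^ 2 * t)) =
        w ^ 3 * ((s + t) * (s ^ 2 + (w + w ^ 2) * s * t + w ^ 3 * t ^ 2)) := by ring
      rw [this, w3, e]; ring
    by_cases hd : lam ∣ s + t
    · obtain ⟨α, hα⟩ := hd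
      -- all three factors are divisible by lam
      set β : Eis := α - s - (1 + w) * t with hβ
      set γ : Eis := α - (1 + w) * s - t with hγ
      have eβ : w * (s + w * t) = lam * β := by
        rw [hβ]; linear_combination hα + (-s - (1 + w) * t) * (-hlam)
      have eγ : w ^ 2 * (s + w ^ 2 * t) = lam * γ := by
        rw [hγ]; linear_combination hα + (-(1 + w) * s - t) * (-hlam) + ((w ^ 2 - w) * t) * hw
      rw [hα, eβ, eγ] at hprod hsum
      have hlr : lam ∣ r := by
        have h1 : lam ^ 3 ∣ (2 * u) * r ^ 3 := ⟨α * β * γ, by rw [← hprod]; ring⟩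
        have h2 : ¬ lam ∣ 2 * u := by
          rw [hu.dvd_mul_right, lam_dvd]; decide
        have h3 := (prime_lam.dvd_or_dvd ((dvd_pow_self lam (by norm_num)).trans h1)).resolve_left h2
        exact prime_lam.dvd_of_dvd_pow h3
      obtain ⟨r', rfl⟩ := hlr
      have hr' : r' ≠ 0 := right_ne_zero_of_mul hr
      have hpr : α * β * γ = 2 * u * r' ^ 3 := by
        apply mul_left_cancel₀ (pow_ne_zero 3 hl0)
        linear_combination hprod
      have hsm : α + β + γ = 0 := by
        apply mul_left_cancel₀ hl0
        linear_combination hsum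
      have hnr : nm r' ≤ n := by
        rw [nm_mul] at hn'
        have : nm lam = 3 := by decide
        have := nm_nonneg r'
        nlinarith
      have hcp : IsCoprime α β := by
        obtain ⟨p, q, h⟩ := hco
        -- t = α - w^2 β,  w s = β - w^2 α
        have ht : t = α - w ^ 2 * β := by
          apply mul_left_cancel₀ hl0
          linear_combination hα - w ^ 2 * eβ + t * hlam + (w - 1) * (s + w * t) * hw
        have hs : s = w ^ 2 * β - w * α := by
          apply mul_left_cancel₀ hl0
          linear_combination w ^ 2 * eβ - w * hα + s * hlam - (w - 1) * (s + w * t) * hw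
        refine ⟨-p * w + q, p * w ^ 2 - q * w ^ 2, ?_⟩
        linear_combination h - p * hs - q * ht
      rw [hα, eβ, eγ]
      rcases core' ih hu hr' hnr hsm hcp hpr with h | h | h
      · left; rw [h]
      · right; left; rw [h]
      · right; right; rw [h]
    · refine core' ih hu hr hn' hsum ?_ hprod
      have h1 : IsCoprime (s + t) lam := ((prime_lam.coprime_iff_not_dvd).2 hd).symm
      obtain ⟨p, q, h⟩ := hco
      obtain ⟨p', q', h'⟩ := h1
      have ht : lam * t = (s + t) - w ^ 2 * (w * (s + w * t)) := by
        rw [hlam]; linear_combination (w - 1) * (s + w * t) * hw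
      have hs : lam * s = w ^ 2 * (w * (s + w * t)) - w * (s + t) := by
        rw [hlam]; linear_combination - (w - 1) * (s + w * t) * hw
      refine ⟨p' + q' * (-p * w + q), q' * (p * w ^ 2 - q * w ^ 2), ?_⟩
      linear_combination h' - q' * p * hs - q' * q * ht + q' * lam * h

lemma cubes {s t r : Eis} (hco : IsCoprime s r) (hr : r ≠ 0)
    (heq : s ^ 3 + t ^ 3 = 2 * r ^ 3) : s ^ 3 = r ^ 3 := by
  have hst : IsCoprime s t := by
    apply isCoprime_of_prime_dvd
    · rintro ⟨rfl, rfl⟩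
      have : (2 : Eis) * r ^ 3 ≠ 0 := mul_ne_zero prime_two.ne_zero (pow_ne_zero _ hr)
      apply this; rw [← heq]; ring
    · intro p hp hs ht
      have hpr : IsCoprime (p ^ 3) (r ^ 3) := (hco.of_isCoprime_of_dvd_left hs).pow
      have h1 : p ^ 3 ∣ 2 * r ^ 3 := by
        rw [← heq]; exact dvd_add (pow_dvd_pow_of_dvd hs 3) (pow_dvd_pow_of_dvd ht 3)
      obtain ⟨q, hq⟩ := hpr.dvd_of_dvd_mul_right h1
      have hn : nm 2 = nm p ^ 3 * nm q := by
        rw [hq]; simp only [pow_succ, pow_zero, one_mul, nm_mul]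
      have h4 : nm 2 = 4 := by decide
      rw [h4] at hn
      have h0 := nm_pos hp.ne_zero
      have hne : nm p ≠ 1 := fun h => hp.not_isUnit (isUnit_of_nm h)
      have h8 : (2 : ℤ) ^ 3 ≤ nm p ^ 3 := pow_le_pow_left₀ (by norm_num) (by omega) 3
      have hq0 : 0 < nm q := by
        by_contra hc
        have := nm_nonneg q
        have : nm q = 0 := by omega
        rw [this] at hn; omega
      nlinarith
  obtain ⟨h1, h2⟩ := descent (nm r + 1).toNat s t r 1
    (by have := nm_nonneg r; omega) isUnit_one hst hr (by rw [heq]; ring)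
  have h0 : (2 : Eis) ≠ 0 := prime_two.ne_zero
  have hne : s ^ 3 + t ^ 3 ≠ 0 := by
    rw [heq]; exact mul_ne_zero h0 (pow_ne_zero _ hr)
  have hfin : s ^ 3 = t ^ 3 := by
    rcases unit_cube h1 with h | h <;> rcases unit_cube h2 with h' | h' <;>
      rw [h, h'] at hne ⊢ <;> simp at hne
  apply mul_left_cancel₀ h0
  linear_combination heq + hfin

lemma split {x : Eis} (hx : x ≠ 0) (y : Eis) :
    ∃ g a b : Eis, g ≠ 0 ∧ x = g * a ∧ y = g * b ∧ IsCoprime a b := by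
  obtain ⟨a, ha⟩ := EuclideanDomain.gcd_dvd_left x y
  obtain ⟨b, hb⟩ := EuclideanDomain.gcd_dvd_right x y
  have hg := EuclideanDomain.gcd_eq_gcd_ab x y
  generalize EuclideanDomain.gcd x y = g at *
  generalize EuclideanDomain.gcdA x y = p at *
  generalize EuclideanDomain.gcdB x y = q at *
  have hg0 : g ≠ 0 := by rintro rfl; apply hx; rw [ha]; ring
  refine ⟨g, a, b, hg0, ha, hb, p, q, ?_⟩
  apply mul_left_cancel₀ hg0
  linear_combination -hg - p * ha - q * hb

lemma lam_aux {c d : Eis} (h : lam ∣ d ^ 3 - 2 * c ^ 3) :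
    lam ^ 2 ∣ d ^ 3 - 2 * c ^ 3 ∧ lam ^ 2 ∣ 2 * d ^ 3 - c ^ 3 := by
  have h3 : (3 : Eis) = lam ^ 2 * (-w ^ 2) := by decide
  have h1 : lam ∣ (d + c) ^ 3 := by
    have : (d + c) ^ 3 = (d ^ 3 - 2 * c ^ 3) + 3 * (c ^ 3 + d ^ 2 * c + d * c ^ 2) := by ring
    rw [this, h3]
    exact dvd_add h ⟨lam * (-w ^ 2) * (c ^ 3 + d ^ 2 * c + d * c ^ 2), by ring⟩
  obtain ⟨e, he⟩ := prime_lam.dvd_of_dvd_pow h1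
  have h4 : d ^ 3 + c ^ 3 = (d + c) ^ 3 - 3 * (d ^ 2 * c + d * c ^ 2) := by ring
  have h5 : lam ^ 2 ∣ d ^ 3 + c ^ 3 := by
    rw [h4, he, h3]
    exact ⟨lam * e ^ 3 + w ^ 2 * (d ^ 2 * c + d * c ^ 2), by ring⟩
  obtain ⟨f, hf⟩ := h5
  exact ⟨⟨f + w ^ 2 * c ^ 3, by linear_combination hf - c ^ 3 * h3⟩,
    ⟨-w ^ 2 * d ^ 3 - f, by linear_combination d ^ 3 * h3 - hf⟩⟩

lemma final {x y x' y' : Eis} (hx : x ≠ 0) (hx' : x' ≠ 0) (hy' : y' ≠ 0)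
    (hn : x * x' = y * y') (h : y ^ 3 + y' ^ 3 = 2 * (x ^ 3 + x' ^ 3)) :
    x ^ 3 = y ^ 3 ∨ x ^ 3 = y' ^ 3 := by
  obtain ⟨g, c, d, hg, rfl, rfl, hcd⟩ := split hx y
  have hn1 : c * x' = d * y' := by
    apply mul_left_cancel₀ hg; linear_combination hn
  have hc0 : c ≠ 0 := right_ne_zero_of_mul hx
  obtain ⟨k, rfl⟩ : c ∣ y' := hcd.dvd_of_dvd_mul_left ⟨x', hn1.symm⟩
  have hx'' : x' = d * k := by
    apply mul_left_cancel₀ hc0; linear_combination hn1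
  subst hx''
  obtain ⟨e, a, b, he, rfl, rfl, hab⟩ := split hg k
  have ha0 : a ≠ 0 := right_ne_zero_of_mul hg
  have hb0 : b ≠ 0 := right_ne_zero_of_mul (right_ne_zero_of_mul hy')
  have h1 : a ^ 3 * (d ^ 3 - 2 * c ^ 3) = b ^ 3 * (2 * d ^ 3 - c ^ 3) := by
    apply mul_left_cancel₀ (pow_ne_zero 3 he); linear_combination h
  obtain ⟨m, hm⟩ : b ^ 3 ∣ d ^ 3 - 2 * c ^ 3 :=
    (hab.symm.pow (m := 3) (n := 3)).dvd_of_dvd_mul_left ⟨_, h1⟩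
  have hm' : 2 * d ^ 3 - c ^ 3 = a ^ 3 * m := by
    apply mul_left_cancel₀ (pow_ne_zero 3 hb0); linear_combination -h1 + a ^ 3 * hm
  have hm3 : m ∣ 3 := by
    obtain ⟨p, q, hpq⟩ := hcd.pow (m := 3) (n := 3)
    refine ⟨p * (a ^ 3 - 2 * b ^ 3) + q * (2 * a ^ 3 - b ^ 3), ?_⟩
    linear_combination -3 * hpq + p * (hm' - 2 * hm) + q * (2 * hm' - hm)
  -- `m` is congruent to one modulo two
  have hd2 : ¬ 2 ∣ d := by
    rintro ⟨d', rfl⟩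
    have h2m : ¬ (2 : Eis) ∣ m := by
      intro h2
      have := h2.trans hm3
      rw [two_dvd] at this
      revert this; decide
    have hb2 : 2 ∣ b ^ 3 * m := by
      rw [← hm]; exact ⟨4 * d' ^ 3 - c ^ 3, by ring⟩
    obtain ⟨b', rfl⟩ := prime_two.dvd_of_dvd_pow ((prime_two.dvd_or_dvd hb2).resolve_right h2m)
    have hc2 : (2 : Eis) ∣ c ^ 3 := by
      refine ⟨2 * d' ^ 3 - 2 * b' ^ 3 * m, ?_⟩
      apply mul_left_cancel₀ prime_two.ne_zero
      linear_combination -hm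
    exact prime_two.not_isUnit
      (hcd.isUnit_of_dvd' (prime_two.dvd_of_dvd_pow hc2) (dvd_mul_right _ _))
  have hb2 : ¬ 2 ∣ b := by
    rintro ⟨b', rfl⟩
    apply hd2
    have : (2 : Eis) ∣ d ^ 3 := ⟨4 * b' ^ 3 * m + c ^ 3, by linear_combination hm⟩
    exact prime_two.dvd_of_dvd_pow this
  have hm1 : 2 ∣ m - 1 := by
    obtain ⟨p, hp⟩ := cube_mod_two hd2
    obtain ⟨q, hq⟩ := cube_mod_two hb2
    exact ⟨p - q * m - c ^ 3, by linear_combination hp - m * hq - hm⟩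
  have h3 : (3 : Eis) = lam ^ 2 * (-w ^ 2) := by decide
  have hml : m ∣ lam ^ 2 := by
    have : lam ^ 2 = 3 * (-w) := by decide
    rw [this]; exact hm3.mul_right _
  obtain ⟨i, hi, v, hv⟩ := (dvd_prime_pow prime_lam 2).1 hml
  have hcases : i = 0 ∨ i = 1 ∨ i = 2 := by omega
  rcases hcases with rfl | rfl | rfl
  · -- `m` is a unit
    left
    have hmu : IsUnit m := IsUnit.of_mul_eq_one (v : Eis) (by simpa using hv)
    have hms : m ^ 3 = m := by
      rcases unit_mod_two hmu hm1 with rfl | rfl <;> ring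
    have := cubes (s := d) (t := -m * b) hcd.symm hc0
      (by rw [mul_pow, neg_pow, hms]; linear_combination hm)
    linear_combination (-(e * a) ^ 3) * this
  · exfalso
    have hlm : lam ∣ m := ⟨(v⁻¹ : Eisˣ), by rw [← pow_one lam, ← hv]; simp⟩
    have hlm2 : ¬ lam ^ 2 ∣ m := by
      rintro ⟨z, hz⟩
      apply prime_lam.not_isUnit
      apply IsUnit.of_mul_eq_one (z * v)
      apply mul_left_cancel₀ prime_lam.ne_zero
      linear_combination hv - v * hz
    obtain ⟨q1, q2⟩ := lam_aux (hm ▸ hlm.mul_left _ : lam ∣ d ^ 3 - 2 * c ^ 3)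
    rw [hm] at q1
    rw [hm'] at q2
    have aux : ∀ z : Eis, lam ^ 2 ∣ z ^ 3 * m → lam ∣ z := by
      intro z hz
      by_contra hc
      exact hlm2 ((((prime_lam.coprime_iff_not_dvd).2 hc).pow (m := 2) (n := 3)).dvd_of_dvd_mul_left hz)
    exact prime_lam.not_isUnit (hab.isUnit_of_dvd' (aux a q2) (aux b q1))
  · -- `m` is three times a unit
    right
    have hvv : (v : Eis) * (v⁻¹ : Eisˣ) = 1 := by simp
    obtain ⟨f, hf, hmf⟩ : ∃ f : Eis, IsUnit f ∧ m = 3 * f := by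
      refine ⟨-w * (v⁻¹ : Eisˣ), ?_, ?_⟩
      · exact IsUnit.mul (by apply isUnit_of_nm; decide) (v⁻¹).isUnit
      · have : lam ^ 2 = 3 * (-w) := by decide
        rw [this] at hv
        linear_combination (v⁻¹ : Eisˣ) * hv - m * hvv
    have hf1 : f = 1 ∨ f = -1 := by
      apply unit_mod_two hf
      obtain ⟨z, hz⟩ := hm1
      exact ⟨z - f, by linear_combination hz - hmf⟩
    have hf2 : f ^ 2 = 1 := by rcases hf1 with rfl | rfl <;> ring
    have hf3 : f ^ 3 = f := by rcases hf1 with rfl | rfl <;> ring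
    have h30 : (3 : Eis) ≠ 0 := by decide
    have := cubes (s := b) (t := f * d) hab.symm ha0 (by
      rw [mul_pow, hf3]
      apply mul_left_cancel₀ h30
      rw [hmf] at hm hm'
      linear_combination f * (2 * hm' - hm) + 3 * (2 * a ^ 3 - b ^ 3) * hf2)
    linear_combination (-(e * c) ^ 3) * this

end Eis

theorem no_solution_quadruple :
    ¬ ∃ k₁ l₁ k₂ l₂ : ℕ, 1 ≤ l₁ ∧ 1 ≤ l₂ ∧ l₁ < k₁ ∧ l₂ < k₂ ∧
      k₁ ^ 2 + k₁ * l₁ + l₁ ^ 2 = k₂ ^ 2 + k₂ * l₂ + l₂ ^ 2 ∧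
      (2 * k₂ + l₂) * (2 * l₂ + k₂) * (k₂ - l₂) =
        2 * ((2 * k₁ + l₁) * (2 * l₁ + k₁) * (k₁ - l₁)) := by
  rintro ⟨k₁, l₁, k₂, l₂, hl₁, hl₂, hk₁, hk₂, hN, hA⟩
  zify [hk₁.le, hk₂.le] at hN hA hl₁ hl₂ hk₁ hk₂
  generalize (k₁ : ℤ) = k at *
  generalize (l₁ : ℤ) = l at *
  generalize (k₂ : ℤ) = p at *
  generalize (l₂ : ℤ) = q at *
  have hpos : 0 < (2 * k + l) * (2 * l + k) * (k - l) := by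
    have h1 : 0 < 2 * k + l := by linarith
    have h2 : 0 < 2 * l + k := by linarith
    have h3 : 0 < k - l := by linarith
    positivity
  have tr : ∀ x y : Eis, x ^ 3 = y ^ 3 →
      2 * (x ^ 3).re - (x ^ 3).im = 2 * (y ^ 3).re - (y ^ 3).im := by
    intro x y h; rw [h]
  have key := Eis.final (x := ⟨k, -l⟩) (x' := ⟨k + l, l⟩) (y := ⟨p, -q⟩) (y' := ⟨p + q, q⟩)
    (by intro h; have := congrArg QuadraticAlgebra.re h; simp at this; linarith)
    (by intro h; have := congrArg QuadraticAlgebra.im h; simp at this; linarith)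
    (by intro h; have := congrArg QuadraticAlgebra.im h; simp at this; linarith)
    (by ext <;> simp <;> linarith)
    (by
      ext
      · simp [pow_succ, Eis.re_two, Eis.im_two]; linarith
      · simp [pow_succ, Eis.re_two, Eis.im_two]; ring)
  rcases key with h | h
  · have := tr _ _ h
    simp [pow_succ] at this
    linarith
  · have := tr _ _ h
    simp [pow_succ] at this
    linarith
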